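/- For all real numbers x, y and y′, one has −2x(x+y) + 4y³( (1/2)x − y − y³ + (1/4)y′³ ) ≤ y² − 4y⁴ − (5/2)y⁶ + (1/2)y′⁶. -/

import Mathlib

/-- Lyapunov-type drift inequality for `W(x,y) = 1 + x² + y⁴` and the delay SDE of
Example 4.2: `−2x(x+y) + 4y³((1/2)x − y − y³ + (1/4)y′³) ≤ y² − 4y⁴ − (5/2)y⁶ + (1/2)y′⁶`. -/
theorem example_drift_inequality (x y y' : ℝ) :
    -2 * x * (x + y) + 4 * y ^ 3 * ((1 / 2) * x - y - y ^ 3 + (1 / 4) * y' ^ 3)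
      ≤ y ^ 2 - 4 * y ^ 4 - (5 / 2) * y ^ 6 + (1 / 2) * y' ^ 6 := by
  linarith [sq_nonneg (x + y), sq_nonneg (x - y ^ 3), sq_nonneg (y ^ 3 - y' ^ 3)]
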